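/- Let F_d be the free group on d ≥ 1 generators with its standard generating set and word metric d(·,·). Then there is a constant C such that for all n and all 0 ≤ s ≤ t ≤ n, the expectation over uniformly random closed lazy words w of length n satisfies E(d(w(s), w(t))) ≤ C·√(t−s). -/

import Mathlib

/-!
Statement 17: Let `F_d` be the free group on `d ≥ 1` generators with its standard
generating set and word metric.  Then there is a constant `C` such that for all `n` and
all `0 ≤ s ≤ t ≤ n`, the expectation over uniformly random closed lazy words `w` of
length `n` satisfies `E(d(w(s), w(t))) ≤ C·√(t−s)`.
-/

namespace AvgDehnPaper

/-- A lazy letter: either the identity (`none`) or a generator or its inverse. -/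
abbrev Letter (d : ℕ) := Option (Fin d × Bool)

/-- The value of a lazy letter in the free group. -/
def letterVal {d : ℕ} : Letter d → FreeGroup (Fin d)
  | none => 1
  | some (i, b) => if b then FreeGroup.of i else (FreeGroup.of i)⁻¹

/-- The position `w(t)` in the free group of the path spelled by a lazy word `w`. -/
def freePos {d n : ℕ} (w : Fin n → Letter d) (t : ℕ) : FreeGroup (Fin d) :=
  (((List.ofFn w).take t).map letterVal).prod

open scoped Classical in
/-- The (finite, nonempty) set of closed lazy words of length `n` in the free group. -/
noncomputable def closedFreeWords (d n : ℕ) : Finset (Fin n → Letter d) :=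
  Finset.univ.filter (fun w => freePos w n = 1)

/-- The operator on radial functions induced by the lazy adjacency operator of the
`(q + 1)`-regular tree. -/
def radialStep (q : ℝ) (F : ℕ → ℝ) : ℕ → ℝ
  | 0 => F 0 + (q + 1) * F 1
  | r + 1 => F (r + 1) + q * F (r + 2) + F r

/-- The element of the free group spelled by a lazy word. -/
def wordVal {d n : ℕ} (w : Fin n → Letter d) : FreeGroup (Fin d) :=
  ((List.ofFn w).map letterVal).prod

section FreeGroup

variable {d : ℕ}

lemma letterVal_some (x : Fin d × Bool) : letterVal (some x) = FreeGroup.mk [x] := by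
  obtain ⟨i, b⟩ := x
  cases b <;> simp [letterVal, FreeGroup.of, FreeGroup.inv_mk, FreeGroup.invRev]

lemma toWord_mk_singleton_mul (x : Fin d × Bool) (g : FreeGroup (Fin d)) :
    (FreeGroup.mk [x] * g).toWord =
      List.casesOn g.toWord [x] fun hd tl =>
        if x.1 = hd.1 ∧ x.2 = not hd.2 then tl else x :: hd :: tl := by
  conv_lhs => rw [← FreeGroup.mk_toWord (x := g), FreeGroup.mul_mk, FreeGroup.toWord_mk]
  rw [List.singleton_append, FreeGroup.reduce.cons, FreeGroup.reduce_toWord]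

lemma sum_norm_letterVal_mul (F : ℕ → ℝ) (g : FreeGroup (Fin d)) :
    ∑ l : Letter d, F (FreeGroup.norm (letterVal l * g)) =
      radialStep (2 * d - 1) F (FreeGroup.norm g) := by
  rw [Fintype.sum_option]
  simp only [letterVal_some, FreeGroup.norm, toWord_mk_singleton_mul]
  simp only [letterVal, one_mul]
  cases g.toWord with
  | nil =>
    simp only [radialStep, List.length_nil, List.length_singleton, Finset.sum_const,
      Finset.card_univ, Fintype.card_prod, Fintype.card_fin, Fintype.card_bool, nsmul_eq_mul]
    push_cast
    ring
  | cons hd tl =>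
    have h : ∀ x : Fin d × Bool,
        F (List.length (if x.1 = hd.1 ∧ x.2 = not hd.2 then tl else x :: hd :: tl)) =
          F (tl.length + 2) +
            if x = (hd.1, !hd.2) then F tl.length - F (tl.length + 2) else 0 := by
      intro x
      by_cases hx : x.1 = hd.1 ∧ x.2 = not hd.2
      · rw [if_pos hx, if_pos (Prod.ext_iff.2 hx)]; ring
      · rw [if_neg hx, if_neg (fun h => hx (by rw [h]; simp))]; simp
    simp only [h, Finset.sum_add_distrib, Finset.sum_ite_eq', Finset.mem_univ, if_true,
      List.length_cons, radialStep]
    simp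
    ring

lemma wordVal_append {m n : ℕ} (u : Fin m → Letter d) (v : Fin n → Letter d) :
    wordVal (Fin.append u v) = wordVal u * wordVal v := by
  simp [wordVal, List.ofFn_fin_append]

lemma sum_append {m n : ℕ} (f : (Fin (m + n) → Letter d) → ℝ) :
    ∑ w, f w = ∑ u : Fin m → Letter d, ∑ v : Fin n → Letter d, f (Fin.append u v) := by
  rw [← (Fin.appendEquiv m n).sum_comp, Fintype.sum_prod_type]
  rfl

lemma sum_norm_wordVal_mul (F : ℕ → ℝ) (k : ℕ) (g : FreeGroup (Fin d)) :
    ∑ u : Fin k → Letter d, F (FreeGroup.norm (wordVal u * g)) =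
      (radialStep (2 * d - 1))^[k] F (FreeGroup.norm g) := by
  induction k generalizing g with
  | zero => simp [wordVal]
  | succ k ih =>
    rw [sum_append, Finset.sum_comm, Function.iterate_succ_apply', ← sum_norm_letterVal_mul,
      ← (Equiv.funUnique (Fin 1) (Letter d)).symm.sum_comp]
    refine Finset.sum_congr rfl fun l _ => ?_
    rw [← ih]
    refine Finset.sum_congr rfl fun u _ => ?_
    rw [wordVal_append, mul_assoc]
    simp [wordVal]

lemma sum_wordVal_mul_eq_one (k : ℕ) (g : FreeGroup (Fin d)) :
    ∑ u : Fin k → Letter d, (if wordVal u * g = 1 then (1 : ℝ) else 0) =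
      (radialStep (2 * d - 1))^[k] (Pi.single 0 1) (FreeGroup.norm g) := by
  rw [← sum_norm_wordVal_mul]
  refine Finset.sum_congr rfl fun u _ => ?_
  simp [Pi.single_apply]

lemma sum_norm_mul_closed (m k : ℕ) :
    ∑ v : Fin m → Letter d, ∑ y : Fin k → Letter d,
      (if wordVal y * wordVal v = 1 then (FreeGroup.norm (wordVal v) : ℝ) else 0) =
      (radialStep (2 * d - 1))^[m]
        (fun r => r * (radialStep (2 * d - 1))^[k] (Pi.single 0 1) r) 0 := by
  have h := sum_norm_wordVal_mul
    (fun r => r * (radialStep (2 * d - 1))^[k] (Pi.single 0 1) r) m (1 : FreeGroup (Fin d))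
  rw [FreeGroup.norm_one] at h
  rw [← h]
  refine Finset.sum_congr rfl fun v _ => ?_
  rw [mul_one, ← sum_wordVal_mul_eq_one, Finset.mul_sum]
  simp

lemma sum_norm_mul_closed_comm (m k : ℕ) :
    ∑ v : Fin m → Letter d, ∑ y : Fin k → Letter d,
      (if wordVal y * wordVal v = 1 then (FreeGroup.norm (wordVal v) : ℝ) else 0) =
    ∑ v : Fin k → Letter d, ∑ y : Fin m → Letter d,
      (if wordVal y * wordVal v = 1 then (FreeGroup.norm (wordVal v) : ℝ) else 0) := by
  rw [Finset.sum_comm]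
  refine Finset.sum_congr rfl fun v _ => Finset.sum_congr rfl fun y _ => ?_
  simp only [mul_eq_one_comm (a := wordVal v)]
  split_ifs with h
  · rw [eq_inv_of_mul_eq_one_left h, FreeGroup.norm_inv_eq]
  · rfl

lemma freePos_self {n : ℕ} (w : Fin n → Letter d) : freePos w n = wordVal w := by
  rw [freePos, wordVal, List.take_of_length_le (by simp)]

lemma card_closedFreeWords (n : ℕ) :
    ((closedFreeWords d n).card : ℝ) =
      (radialStep (2 * d - 1))^[n] (Pi.single 0 1) 0 := by
  have h := sum_wordVal_mul_eq_one n (1 : FreeGroup (Fin d))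
  rw [FreeGroup.norm_one] at h
  rw [← h, closedFreeWords, Finset.card_filter]
  push_cast
  simp [freePos_self]

lemma sum_closedFreeWords_norm (s m r : ℕ) :
    ∑ w ∈ closedFreeWords d (s + (m + r)),
      (FreeGroup.norm ((freePos w s)⁻¹ * freePos w (s + m)) : ℝ) =
    ∑ v : Fin m → Letter d, ∑ y : Fin (r + s) → Letter d,
      (if wordVal y * wordVal v = 1 then (FreeGroup.norm (wordVal v) : ℝ) else 0) := by
  rw [closedFreeWords, Finset.sum_filter, sum_append]
  simp only [sum_append, freePos_self]
  rw [Finset.sum_comm]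
  refine Finset.sum_congr rfl fun v _ => ?_
  rw [Finset.sum_comm]
  refine Finset.sum_congr rfl fun x _ => Finset.sum_congr rfl fun u _ => ?_
  have h₁ : freePos (Fin.append u (Fin.append v x)) s = wordVal u := by
    simp [freePos, wordVal, List.ofFn_fin_append]
  have h₂ : freePos (Fin.append u (Fin.append v x)) (s + m) = wordVal u * wordVal v := by
    simp [freePos, wordVal, List.ofFn_fin_append, List.take_append, List.take_of_length_le]
  rw [h₁, h₂, inv_mul_cancel_left]
  simp only [wordVal_append]
  have h₃ : wordVal u * (wordVal v * wordVal x) = 1 ↔ wordVal x * wordVal u * wordVal v = 1 := by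
    rw [mul_eq_one_comm, mul_assoc, mul_eq_one_comm]
  simp only [h₃]

end FreeGroup

section Radial

lemma radialStep_mono {q : ℝ} (hq : 0 ≤ q) : Monotone (radialStep q) := by
  intro F G h r
  cases r with
  | zero =>
    simp only [radialStep]
    have := mul_le_mul_of_nonneg_left (h 1) (by linarith : 0 ≤ q + 1)
    linarith [h 0]
  | succ r =>
    simp only [radialStep]
    have := mul_le_mul_of_nonneg_left (h (r + 2)) hq
    linarith [h (r + 1), h r]

lemma iterate_radialStep_single_nonneg {q : ℝ} (hq : 0 ≤ q) (k : ℕ) :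
    0 ≤ (radialStep q)^[k] (Pi.single 0 1) := by
  induction k with
  | zero => simp [Pi.single_nonneg]
  | succ k ih =>
    rw [Function.iterate_succ_apply']
    refine le_trans (le_of_eq ?_) (radialStep_mono hq ih)
    ext r
    cases r <;> simp [radialStep]

lemma iterate_radialStep_single_zero_mono {q : ℝ} (hq : 0 ≤ q) :
    Monotone fun k => (radialStep q)^[k] (Pi.single 0 1) 0 := by
  refine monotone_nat_of_le_succ fun k => ?_
  have h := iterate_radialStep_single_nonneg hq k 1
  simp only [Function.iterate_succ_apply', radialStep]
  exact le_add_of_nonneg_right (mul_nonneg (by linarith) h)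

/-- The spherical function of the `(s ^ 2 + 1)`-regular tree with eigenvalue `2 * s * x`. -/
noncomputable def spherical (s x : ℝ) (r : ℕ) : ℝ :=
  ((s ^ 2 - 1) * (Polynomial.Chebyshev.U ℝ r).eval x +
    2 * (Polynomial.Chebyshev.T ℝ r).eval x) / (s ^ 2 + 1) * s⁻¹ ^ r

/-- The positive spherical function at the top of the spectrum. -/
noncomputable def groundState (s : ℝ) (r : ℕ) : ℝ :=
  ((s ^ 2 + 1) + (s ^ 2 - 1) * r) / (s ^ 2 + 1) * s⁻¹ ^ r

lemma spherical_zero (s x : ℝ) : spherical s x 0 = 1 := by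
  have : s ^ 2 + 1 ≠ 0 := by positivity
  simp [spherical]
  field_simp
  ring

lemma groundState_zero (s : ℝ) : groundState s 0 = 1 := by
  have : s ^ 2 + 1 ≠ 0 := by positivity
  simp [groundState, this]

lemma groundState_nonneg {s : ℝ} (hs : 1 ≤ s) (r : ℕ) : 0 ≤ groundState s r := by
  have : 0 ≤ s ^ 2 - 1 := by nlinarith
  unfold groundState
  positivity

lemma radialStep_spherical {s : ℝ} (hs : s ≠ 0) (x : ℝ) (r : ℕ) :
    radialStep (s ^ 2) (spherical s x) r = (1 + 2 * s * x) * spherical s x r := by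
  have h : s ^ 2 + 1 ≠ 0 := by positivity
  cases r with
  | zero =>
    simp only [radialStep, spherical_zero]
    simp [spherical]
    field_simp
    ring
  | succ r =>
    have hT := congrArg (Polynomial.eval x) (Polynomial.Chebyshev.T_add_two ℝ r)
    have hU := congrArg (Polynomial.eval x) (Polynomial.Chebyshev.U_add_two ℝ r)
    simp only [Polynomial.eval_sub, Polynomial.eval_mul, Polynomial.eval_X,
      Polynomial.eval_ofNat] at hT hU
    simp only [radialStep, spherical]
    push_cast
    have h₁ : s⁻¹ ^ (r + 1) = s * s⁻¹ ^ (r + 2) := by simp only [inv_pow]; field_simp; ring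
    have h₂ : s⁻¹ ^ r = s ^ 2 * s⁻¹ ^ (r + 2) := by simp only [inv_pow]; field_simp; ring
    rw [hT, hU, h₁, h₂]
    generalize s⁻¹ ^ (r + 2) = Y
    field_simp
    ring

lemma abs_eval_U_cos_le (θ : ℝ) (r : ℕ) :
    |(Polynomial.Chebyshev.U ℝ r).eval (Real.cos θ)| ≤ r + 1 := by
  induction r with
  | zero => simp
  | succ r ih =>
    have h := congrArg (Polynomial.eval (Real.cos θ))
      (Polynomial.Chebyshev.U_eq_X_mul_U_add_T ℝ r)
    simp only [Polynomial.eval_add, Polynomial.eval_mul, Polynomial.eval_X,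
      Polynomial.Chebyshev.T_real_cos] at h
    push_cast
    rw [h]
    refine (abs_add_le _ _).trans (add_le_add ?_ (Real.abs_cos_le_one _))
    rw [abs_mul]
    exact (mul_le_of_le_one_left (abs_nonneg _) (Real.abs_cos_le_one _)).trans ih

lemma abs_spherical_cos_le {s : ℝ} (hs : 1 ≤ s) (θ : ℝ) (r : ℕ) :
    |spherical s (Real.cos θ) r| ≤ groundState s r := by
  have h : 0 ≤ s ^ 2 - 1 := by nlinarith
  have h' : 0 < s ^ 2 + 1 := by positivity
  have h'' : 0 ≤ s⁻¹ ^ r := by positivity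
  rw [spherical, groundState, abs_mul, abs_div, abs_of_pos h', abs_of_nonneg h'']
  gcongr
  refine (abs_add_le _ _).trans ?_
  rw [abs_mul, abs_mul, abs_of_nonneg h, Polynomial.Chebyshev.T_real_cos, abs_two]
  have h₁ := mul_le_mul_of_nonneg_left (abs_eval_U_cos_le θ r) h
  have h₂ := Real.abs_cos_le_one ((r : ℤ) * θ)
  linarith

lemma radialStep_groundState_mul_le {s : ℝ} (hs : 1 ≤ s) {α : ℝ} (hα : 0 ≤ α) (β : ℝ) (r : ℕ) :
    radialStep (s ^ 2) (fun r => groundState s r * (α * r ^ 2 + β)) r ≤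
      (1 + 2 * s) * (groundState s r * (α * r ^ 2 + β + 3 * α)) := by
  have h : 0 < s ^ 2 + 1 := by positivity
  have hs0 : s ≠ 0 := by positivity
  rw [← sub_nonneg]
  cases r with
  | zero =>
    simp only [radialStep, groundState_zero]
    have : (1 + 2 * s) * (1 * (α * ((0 : ℕ) : ℝ) ^ 2 + β + 3 * α)) -
        (1 * (α * ((0 : ℕ) : ℝ) ^ 2 + β) + (s ^ 2 + 1) *
          (groundState s 1 * (α * ((1 : ℕ) : ℝ) ^ 2 + β))) = α * (3 + 4 * s) := by
      simp [groundState]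
      field_simp
      ring
    rw [this]
    positivity
  | succ r =>
    have hq : 0 ≤ s ^ 2 - 1 := by nlinarith
    have h₁ : s⁻¹ ^ (r + 1) = s * s⁻¹ ^ (r + 2) := by simp only [inv_pow]; field_simp; ring
    have h₂ : s⁻¹ ^ r = s ^ 2 * s⁻¹ ^ (r + 2) := by simp only [inv_pow]; field_simp; ring
    have : (1 + 2 * s) * (groundState s (r + 1) * (α * ((r + 1 : ℕ) : ℝ) ^ 2 + β + 3 * α)) -
        radialStep (s ^ 2) (fun r => groundState s r * (α * r ^ 2 + β)) (r + 1) =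
        α * (s⁻¹ ^ (r + 1) / (s ^ 2 + 1)) *
          (3 * ((s ^ 2 + 1) + (s ^ 2 - 1) * (r + 1)) + 4 * s * (s ^ 2 + 1)) := by
      simp only [radialStep, groundState]
      push_cast
      rw [h₁, h₂]
      generalize s⁻¹ ^ (r + 2) = Y
      field_simp
      ring
    rw [this]
    positivity

lemma iterate_radialStep_le {s : ℝ} (hs : 1 ≤ s) {α β : ℝ} (hα : 0 ≤ α) {F : ℕ → ℝ}
    (hF : ∀ r, F r ≤ groundState s r * (α * r ^ 2 + β)) (m r : ℕ) :
    (radialStep (s ^ 2))^[m] F r ≤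
      (1 + 2 * s) ^ m * (groundState s r * (α * r ^ 2 + (β + 3 * α * m))) := by
  induction m generalizing F α β r with
  | zero => simpa using hF r
  | succ m ih =>
    have hs' : 0 ≤ 1 + 2 * s := by linarith
    have h : ∀ r, radialStep (s ^ 2) F r ≤
        groundState s r * ((1 + 2 * s) * α * r ^ 2 + (1 + 2 * s) * (β + 3 * α)) := fun r => by
      refine (radialStep_mono (sq_nonneg s) hF r).trans ?_
      refine (radialStep_groundState_mul_le hs hα β r).trans (le_of_eq ?_)
      ring
    rw [Function.iterate_succ_apply]
    refine (ih (mul_nonneg hs' hα) h r).trans (le_of_eq ?_)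
    push_cast
    ring

end Radial

section Spectral

open Real intervalIntegral Polynomial.Chebyshev

lemma integral_cos_nat_mul {r : ℕ} (hr : r ≠ 0) : ∫ θ in (0)..π, cos (r * θ) = 0 := by
  have : (r : ℝ) ≠ 0 := by exact_mod_cast hr
  rw [integral_comp_mul_left _ this]
  simp [sin_nat_mul_pi]

lemma integral_sin_mul_sin {r : ℕ} (hr : r ≠ 0) :
    ∫ θ in (0)..π, sin θ * sin ((r + 1) * θ) = 0 := by
  have h : ∀ θ : ℝ, sin θ * sin ((r + 1) * θ) =
      (cos ((r : ℕ) * θ) - cos ((r + 2 : ℕ) * θ)) / 2 := by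
    intro θ
    have := two_mul_sin_mul_sin ((r + 1) * θ) θ
    rw [show (r + 1) * θ - θ = r * θ by ring, show (r + 1) * θ + θ = (r + 2) * θ by ring] at this
    push_cast
    linarith
  simp_rw [h]
  rw [integral_div, integral_sub (Continuous.intervalIntegrable (by fun_prop) _ _)
    (Continuous.intervalIntegrable (by fun_prop) _ _), integral_cos_nat_mul hr,
    integral_cos_nat_mul (by omega)]
  simp

lemma continuous_spherical_cos (s : ℝ) (r : ℕ) : Continuous fun θ => spherical s (cos θ) r := by
  unfold spherical
  fun_prop

/-- The unnormalised density of the spectral measure of the `(q + 1)`-regular tree, at the point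
`2 * √q * cos θ` of the spectrum. -/
noncomputable def treeDensity (q θ : ℝ) : ℝ :=
  sin θ ^ 2 / ((q - 1) ^ 2 + 4 * q * sin θ ^ 2)

section treeDensity

variable {q : ℝ}

lemma treeDensity_denom_pos (hq : 1 < q) (θ : ℝ) : 0 < (q - 1) ^ 2 + 4 * q * sin θ ^ 2 := by
  have : 0 < (q - 1) ^ 2 := pow_pos (sub_pos.2 hq) 2
  positivity

lemma treeDensity_nonneg (hq : 1 < q) (θ : ℝ) : 0 ≤ treeDensity q θ :=
  div_nonneg (sq_nonneg _) (treeDensity_denom_pos hq θ).le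

lemma continuous_treeDensity (hq : 1 < q) : Continuous (treeDensity q) :=
  Continuous.div (by fun_prop) (by fun_prop) fun θ => (treeDensity_denom_pos hq θ).ne'

lemma treeDensity_two_mul_le (hq : 1 < q) (θ : ℝ) : treeDensity q (2 * θ) ≤ 4 * treeDensity q θ := by
  have h₁ := treeDensity_denom_pos hq θ
  have h₂ := treeDensity_denom_pos hq (2 * θ)
  unfold treeDensity
  rw [← mul_div_assoc, div_le_div_iff₀ h₂ h₁, sin_two_mul]
  have h : cos θ ^ 2 = 1 - sin θ ^ 2 := cos_sq' θ
  have key : 4 * sin θ ^ 2 * ((q - 1) ^ 2 + 4 * q * (2 * sin θ * cos θ) ^ 2) -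
      (2 * sin θ * cos θ) ^ 2 * ((q - 1) ^ 2 + 4 * q * sin θ ^ 2) =
      4 * sin θ ^ 2 * ((q - 1) ^ 2 * sin θ ^ 2 + 12 * q * sin θ ^ 2 * cos θ ^ 2) := by
    linear_combination (-4 * sin θ ^ 2 * (q - 1) ^ 2) * h
  rw [← sub_nonneg, key]
  positivity

lemma integral_treeDensity_pos (hq : 1 < q) : 0 < ∫ θ in (0)..π, treeDensity q θ :=
  intervalIntegral_pos_of_pos_on ((continuous_treeDensity hq).intervalIntegrable _ _)
    (fun θ hθ => div_pos (pow_pos (sin_pos_of_mem_Ioo hθ) 2) (treeDensity_denom_pos hq θ)) pi_pos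

lemma treeDensity_mul_sub (hq : 1 < q) (r : ℕ) (θ : ℝ) :
    q * (treeDensity q θ * ((q - 1) * (U ℝ r).eval (cos θ) + 2 * (T ℝ r).eval (cos θ))) -
      treeDensity q θ *
        ((q - 1) * (U ℝ (r + 2 : ℕ)).eval (cos θ) + 2 * (T ℝ (r + 2 : ℕ)).eval (cos θ)) =
      sin θ * sin ((r + 1) * θ) := by
  have h₁ := congrArg (Polynomial.eval (cos θ)) (U_add_two ℝ r)
  have h₂ := congrArg (Polynomial.eval (cos θ)) (T_add_two ℝ r)
  have h₃ := congrArg (Polynomial.eval (cos θ)) (U_eq_X_mul_U_add_T ℝ r)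
  have h₄ := congrArg (Polynomial.eval (cos θ)) (T_eq_X_mul_U_sub_U ℝ r)
  have h₅ := U_real_cos θ r
  simp only [Polynomial.eval_sub, Polynomial.eval_mul, Polynomial.eval_X, Polynomial.eval_add,
      Polynomial.eval_ofNat] at h₁ h₂ h₃ h₄
  have hD := (treeDensity_denom_pos hq θ).ne'
  push_cast at h₅ ⊢
  rw [← h₅, treeDensity, mul_left_comm, ← mul_sub]
  have hc := cos_sq' θ
  generalize (U ℝ r).eval (cos θ) = a at *
  generalize (U ℝ (r + 1)).eval (cos θ) = b at *
  generalize (U ℝ (r + 2)).eval (cos θ) = e at *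
  generalize (T ℝ r).eval (cos θ) = t at *
  generalize (T ℝ (r + 1)).eval (cos θ) = t₁ at *
  generalize (T ℝ (r + 2)).eval (cos θ) = t₂ at *
  have e₁ : t₁ = b - cos θ * a := by linarith
  have e₂ : t = 2 * cos θ * (b - cos θ * a) - (cos θ * b - a) := by rw [← e₁]; linarith
  have key : q * ((q - 1) * a + 2 * t) - ((q - 1) * e + 2 * t₂) =
      a * ((q - 1) ^ 2 + 4 * q * sin θ ^ 2) := by
    rw [e₂, h₁, h₄]
    linear_combination (-4 * q * a) * hc
  rw [key, div_mul_eq_mul_div, div_eq_iff hD]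
  ring

lemma integral_treeDensity_mul_eq_zero (hq : 1 < q) {r : ℕ} (hr : r ≠ 0) :
    ∫ θ in (0)..π, treeDensity q θ *
      ((q - 1) * (U ℝ r).eval (cos θ) + 2 * (T ℝ r).eval (cos θ)) = 0 := by
  set K : ℕ → ℝ := fun r => ∫ θ in (0)..π, treeDensity q θ *
      ((q - 1) * (U ℝ r).eval (cos θ) + 2 * (T ℝ r).eval (cos θ))
  have hcont := continuous_treeDensity hq
  have hstep : ∀ r : ℕ, r ≠ 0 → K (r + 2) = q * K r := by
    intro r hr
    have h := integral_sin_mul_sin hr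
    simp_rw [← treeDensity_mul_sub hq] at h
    rw [integral_sub (Continuous.intervalIntegrable (by fun_prop) _ _)
      (Continuous.intervalIntegrable (by fun_prop) _ _), integral_const_mul] at h
    exact (sub_eq_zero.1 h).symm
  have hpow : ∀ j : ℕ, K (r + 2 * j) = q ^ j * K r := by
    intro j
    induction j with
    | zero => simp
    | succ j ih => rw [mul_add_one, ← add_assoc, hstep _ (by omega), ih]; ring
  have hbound : ∀ r, |K r| ≤ (q + 1) / (q - 1) ^ 2 * |π - 0| := by
    intro r
    rw [← Real.norm_eq_abs]
    refine norm_integral_le_of_norm_le_const fun θ _ => ?_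
    have hq' : 0 < (q - 1) ^ 2 := pow_pos (sub_pos.2 hq) 2
    have hU := U_real_cos θ r
    rw [T_real_cos, treeDensity, norm_eq_abs, div_mul_eq_mul_div, abs_div,
      abs_of_pos (treeDensity_denom_pos hq θ)]
    refine div_le_div₀ (by linarith) ?_ hq'
      (le_add_of_nonneg_right (by positivity))
    have : sin θ ^ 2 * ((q - 1) * (U ℝ r).eval (cos θ) + 2 * cos ((r : ℤ) * θ)) =
        (q - 1) * (sin θ * sin (((r : ℤ) + 1) * θ)) + 2 * (sin θ ^ 2 * cos ((r : ℤ) * θ)) := by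
      rw [← hU]; ring
    rw [this]
    refine (abs_add_le _ _).trans ?_
    simp only [abs_mul, abs_of_pos (sub_pos.2 hq), abs_two, abs_pow]
    have h₁ := mul_le_one₀ (abs_sin_le_one θ) (abs_nonneg _) (abs_sin_le_one (((r : ℤ) + 1) * θ))
    have h₂ := mul_le_one₀ (pow_le_one₀ (abs_nonneg _) (abs_sin_le_one θ) (n := 2))
      (abs_nonneg _) (abs_cos_le_one ((r : ℤ) * θ))
    nlinarith
  by_contra hne
  have hpos : 0 < |K r| := abs_pos.2 hne
  obtain ⟨j, hj⟩ := pow_unbounded_of_one_lt ((q + 1) / (q - 1) ^ 2 * |π - 0| / |K r|) hq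
  have h := hbound (r + 2 * j)
  rw [hpow, abs_mul, abs_of_pos (by positivity : 0 < q ^ j)] at h
  rw [div_lt_iff₀ hpos] at hj
  linarith

end treeDensity

lemma exists_spectral_weight {s : ℝ} (hs : 1 ≤ s) :
    ∃ w : ℝ → ℝ, Continuous w ∧ (∀ θ, 0 ≤ w θ) ∧ (∀ θ, w (π - θ) = w θ) ∧
      (∀ θ, w (2 * θ) ≤ 4 * w θ) ∧
      ∀ r, ∫ θ in (0)..π, w θ * spherical s (cos θ) r = Pi.single (M := fun _ => ℝ) 0 1 r := by
  rcases hs.eq_or_lt with rfl | hs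
  · refine ⟨fun _ => π⁻¹, continuous_const, fun _ => by positivity, fun _ => rfl,
      fun _ => by linarith [inv_pos.2 pi_pos], fun r => ?_⟩
    have h : ∀ θ, spherical 1 (cos θ) r = cos (r * θ) := by
      intro θ
      norm_num [spherical]
    simp_rw [h, integral_const_mul]
    rcases eq_or_ne r 0 with rfl | hr
    · simp [pi_ne_zero]
    · simp [integral_cos_nat_mul hr, hr]
  · have hq : 1 < s ^ 2 := one_lt_pow₀ hs two_ne_zero
    have hZ := integral_treeDensity_pos hq
    refine ⟨fun θ => (∫ θ in (0)..π, treeDensity (s ^ 2) θ)⁻¹ * treeDensity (s ^ 2) θ,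
      (continuous_treeDensity hq).const_mul _,
      fun θ => mul_nonneg (inv_pos.2 hZ).le (treeDensity_nonneg hq θ),
      fun θ => by simp [treeDensity, sin_pi_sub], fun θ => ?_, fun r => ?_⟩
    · have := mul_le_mul_of_nonneg_left (treeDensity_two_mul_le hq θ) (inv_pos.2 hZ).le
      linarith
    · simp_rw [mul_assoc, integral_const_mul]
      rcases eq_or_ne r 0 with rfl | hr
      · simp [spherical_zero, hZ.ne']
      · have h : ∀ θ, treeDensity (s ^ 2) θ * spherical s (cos θ) r =
            treeDensity (s ^ 2) θ *
              ((s ^ 2 - 1) * (U ℝ r).eval (cos θ) + 2 * (T ℝ r).eval (cos θ)) *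
                (s⁻¹ ^ r / (s ^ 2 + 1)) := by
          intro θ
          unfold spherical
          ring
        simp_rw [h, integral_mul_const, integral_treeDensity_mul_eq_zero hq hr]
        simp [hr]

section Weight

variable {s : ℝ} {w : ℝ → ℝ}

lemma iterate_radialStep_eq_integral (hs : s ≠ 0) (hw : Continuous w)
    (hsph : ∀ r, ∫ θ in (0)..π, w θ * spherical s (cos θ) r =
      Pi.single (M := fun _ => ℝ) 0 1 r) (k r : ℕ) :
    (radialStep (s ^ 2))^[k] (Pi.single 0 1) r =
      ∫ θ in (0)..π, (1 + 2 * s * cos θ) ^ k * (w θ * spherical s (cos θ) r) := by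
  induction k generalizing r with
  | zero => simp [hsph]
  | succ k ih =>
    have hint : ∀ r, IntervalIntegrable
        (fun θ => (1 + 2 * s * cos θ) ^ k * (w θ * spherical s (cos θ) r))
        MeasureTheory.volume 0 π := fun r =>
      Continuous.intervalIntegrable
        (by have := continuous_spherical_cos s r; fun_prop) _ _
    have h : ∀ θ, (1 + 2 * s * cos θ) ^ (k + 1) * (w θ * spherical s (cos θ) r) =
        (1 + 2 * s * cos θ) ^ k * (w θ * radialStep (s ^ 2) (spherical s (cos θ)) r) := by
      intro θ
      rw [radialStep_spherical hs]
      ring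
    simp_rw [h]
    rw [Function.iterate_succ_apply']
    cases r with
    | zero =>
      simp only [radialStep, ih]
      rw [← integral_const_mul, ← integral_add (hint _) ((hint _).const_mul _)]
      exact integral_congr fun θ _ => by ring
    | succ r =>
      simp only [radialStep, ih]
      rw [← integral_const_mul, ← integral_add (hint _) ((hint _).const_mul _),
        ← integral_add ((hint _).add ((hint _).const_mul _)) (hint _)]
      exact integral_congr fun θ _ => by ring

lemma iterate_radialStep_le_groundState (hs : 1 ≤ s) (hw : Continuous w) (hw₀ : ∀ θ, 0 ≤ w θ)
    (hsph : ∀ r, ∫ θ in (0)..π, w θ * spherical s (cos θ) r =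
      Pi.single (M := fun _ => ℝ) 0 1 r) (k r : ℕ) :
    (radialStep (s ^ 2))^[k] (Pi.single 0 1) r ≤
      groundState s r * ∫ θ in (0)..π, |1 + 2 * s * cos θ| ^ k * w θ := by
  rw [iterate_radialStep_eq_integral (by positivity) hw hsph, ← integral_const_mul]
  refine integral_mono_on pi_pos.le
    (Continuous.intervalIntegrable (by have := continuous_spherical_cos s r; fun_prop) _ _)
    (Continuous.intervalIntegrable (by fun_prop) _ _) fun θ _ => ?_
  refine (le_abs_self _).trans ?_
  rw [abs_mul, abs_mul, abs_pow, abs_of_nonneg (hw₀ θ)]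
  have := mul_le_mul_of_nonneg_left (abs_spherical_cos_le hs θ r)
    (mul_nonneg (pow_nonneg (abs_nonneg (1 + 2 * s * cos θ)) k) (hw₀ θ))
  linarith

lemma integral_abs_pow_mul_le (hs : 0 ≤ s) (hw : Continuous w) (hw₀ : ∀ θ, 0 ≤ w θ)
    (hrefl : ∀ θ, w (π - θ) = w θ) (k : ℕ) :
    ∫ θ in (0)..π, |1 + 2 * s * cos θ| ^ k * w θ ≤
      2 * ∫ θ in (0)..(π / 2), (1 + 2 * s * cos θ) ^ k * w θ := by
  have hint : ∀ a b, IntervalIntegrable (fun θ => |1 + 2 * s * cos θ| ^ k * w θ)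
      MeasureTheory.volume a b := fun a b => Continuous.intervalIntegrable (by fun_prop) _ _
  have hint' : IntervalIntegrable (fun θ => (1 + 2 * s * cos θ) ^ k * w θ)
      MeasureTheory.volume 0 (π / 2) := Continuous.intervalIntegrable (by fun_prop) _ _
  have hint_refl : IntervalIntegrable (fun θ => |1 + 2 * s * cos (π - θ)| ^ k * w (π - θ))
      MeasureTheory.volume 0 (π / 2) := Continuous.intervalIntegrable (by fun_prop) _ _
  have hpi : (0 : ℝ) ≤ π / 2 := by positivity
  have hsub := integral_comp_sub_left (fun θ => |1 + 2 * s * cos θ| ^ k * w θ) π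
    (a := 0) (b := π / 2)
  rw [sub_zero, show π - π / 2 = π / 2 by ring] at hsub
  rw [← integral_add_adjacent_intervals (hint 0 (π / 2)) (hint (π / 2) π), ← hsub,
    two_mul (intervalIntegral _ _ _ _)]
  refine add_le_add (integral_mono_on hpi (hint _ _) hint' fun θ hθ => ?_)
    (integral_mono_on hpi hint_refl hint' fun θ hθ => ?_)
  all_goals
    have hc : 0 ≤ s * cos θ :=
      mul_nonneg hs (cos_nonneg_of_mem_Icc ⟨by linarith [hθ.1, pi_pos], hθ.2⟩)
  · rw [abs_of_nonneg (by linarith)]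
  · rw [hrefl, cos_pi_sub]
    refine mul_le_mul_of_nonneg_right (pow_le_pow_left₀ (abs_nonneg _) ?_ k) (hw₀ θ)
    exact abs_le.2 ⟨by linarith, by linarith⟩

lemma integral_pow_mul_doubling (hs : 0 ≤ s) (hw : Continuous w) (hw₀ : ∀ θ, 0 ≤ w θ)
    (hdbl : ∀ θ, w (2 * θ) ≤ 4 * w θ) (k : ℕ) :
    (1 + 2 * s) ^ k * ∫ θ in (0)..(π / 2), (1 + 2 * s * cos θ) ^ k * w θ ≤
      8 * ∫ θ in (0)..(π / 4), (1 + 2 * s * cos θ) ^ (2 * k) * w θ := by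
  have hsub := mul_integral_comp_mul_left (a := 0) (b := π / 4)
    (f := fun θ => (1 + 2 * s * cos θ) ^ k * w θ) (c := 2)
  rw [mul_zero, show 2 * (π / 4) = π / 2 by ring] at hsub
  rw [← hsub, ← integral_const_mul, ← integral_const_mul, ← integral_const_mul]
  refine integral_mono_on (by positivity) (Continuous.intervalIntegrable (by fun_prop) _ _)
    (Continuous.intervalIntegrable (by fun_prop) _ _) fun θ hθ => ?_
  have hc : 0 ≤ cos θ :=
    cos_nonneg_of_mem_Icc ⟨by linarith [hθ.1, pi_pos], by linarith [hθ.2, pi_pos]⟩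
  have hc₂ : 0 ≤ cos (2 * θ) :=
    cos_nonneg_of_mem_Icc ⟨by linarith [hθ.1, pi_pos], by linarith [hθ.2, pi_pos]⟩
  have hsc₂ : 0 ≤ s * cos (2 * θ) := mul_nonneg hs hc₂
  have h : (1 + 2 * s) * (1 + 2 * s * cos (2 * θ)) ≤ (1 + 2 * s * cos θ) ^ 2 := by
    rw [cos_two_mul]
    have h₁ : 0 ≤ s * (cos θ * (1 - cos θ)) :=
      mul_nonneg hs (mul_nonneg hc (sub_nonneg.2 (cos_le_one θ)))
    have h₂ : 0 ≤ s ^ 2 * (1 - cos θ ^ 2) :=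
      mul_nonneg (sq_nonneg s) (sub_nonneg.2 (cos_sq_le_one θ))
    linarith
  have hk := pow_le_pow_left₀ (by positivity) h k
  rw [mul_pow, ← pow_mul] at hk
  have := mul_le_mul hk (hdbl θ) (hw₀ _) (pow_nonneg (by positivity) _)
  linarith

lemma integral_abs_pow_mul_le_iterate (hs : 1 ≤ s) (hw : Continuous w) (hw₀ : ∀ θ, 0 ≤ w θ)
    (hrefl : ∀ θ, w (π - θ) = w θ) (hdbl : ∀ θ, w (2 * θ) ≤ 4 * w θ)
    (hsph : ∀ r, ∫ θ in (0)..π, w θ * spherical s (cos θ) r =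
      Pi.single (M := fun _ => ℝ) 0 1 r) {m k : ℕ} (hmk : m ≤ k) :
    (1 + 2 * s) ^ m * ∫ θ in (0)..π, |1 + 2 * s * cos θ| ^ k * w θ ≤
      16 * (1 + 2 * s) * (radialStep (s ^ 2))^[m + k] (Pi.single 0 1) 0 := by
  have hs₀ : 0 ≤ s := by linarith
  have hρ : 1 ≤ 1 + 2 * s := by linarith
  set l := (m + k) / 2
  have hT : ∫ θ in (0)..π, (1 + 2 * s * cos θ) ^ (2 * l) * w θ ≤
      (radialStep (s ^ 2))^[m + k] (Pi.single 0 1) 0 := by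
    refine le_trans (le_of_eq ?_)
      (iterate_radialStep_single_zero_mono (sq_nonneg s) (by omega : 2 * l ≤ m + k))
    simp only [iterate_radialStep_eq_integral (by positivity) hw hsph, spherical_zero, mul_one]
  have hquarter : ∫ θ in (0)..(π / 4), (1 + 2 * s * cos θ) ^ (2 * k) * w θ ≤
      (1 + 2 * s) ^ (2 * k - 2 * l) * ∫ θ in (0)..π, (1 + 2 * s * cos θ) ^ (2 * l) * w θ := by
    rw [← integral_const_mul]
    refine (integral_mono_on (by positivity) (Continuous.intervalIntegrable (by fun_prop) _ _)
      (Continuous.intervalIntegrable (by fun_prop) _ _) fun θ hθ => ?_).trans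
      (integral_mono_interval le_rfl (by positivity) (by linarith [pi_pos])
        (Filter.Eventually.of_forall fun θ => ?_)
        (Continuous.intervalIntegrable (by fun_prop) _ _))
    · have hc : 0 ≤ cos θ :=
        cos_nonneg_of_mem_Icc ⟨by linarith [hθ.1, pi_pos], by linarith [hθ.2, pi_pos]⟩
      rw [← mul_assoc]
      refine mul_le_mul_of_nonneg_right ?_ (hw₀ θ)
      rw [show 2 * k = (2 * k - 2 * l) + 2 * l by omega, pow_add, Nat.add_sub_cancel]
      refine mul_le_mul_of_nonneg_right (pow_le_pow_left₀ (by positivity) ?_ _) (by positivity)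
      have := mul_le_mul_of_nonneg_left (cos_le_one θ) hs₀
      linarith
    · have := hw₀ θ
      simp only [Pi.zero_apply, pow_mul]
      positivity
  have hpow : (1 + 2 * s) ^ (2 * k - 2 * l) ≤ (1 + 2 * s) ^ (k - m) * (1 + 2 * s) := by
    rw [← pow_succ]
    exact pow_le_pow_right₀ hρ (by omega)
  have hTnn := iterate_radialStep_single_nonneg (sq_nonneg s) (m + k) 0
  refine le_of_mul_le_mul_left ?_ (by positivity : 0 < (1 + 2 * s) ^ (k - m))
  calc (1 + 2 * s) ^ (k - m) *
        ((1 + 2 * s) ^ m * ∫ θ in (0)..π, |1 + 2 * s * cos θ| ^ k * w θ)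
      = (1 + 2 * s) ^ k * ∫ θ in (0)..π, |1 + 2 * s * cos θ| ^ k * w θ := by
        rw [← mul_assoc, ← pow_add, Nat.sub_add_cancel hmk]
    _ ≤ (1 + 2 * s) ^ k * (2 * ∫ θ in (0)..(π / 2), (1 + 2 * s * cos θ) ^ k * w θ) := by
        gcongr
        exact integral_abs_pow_mul_le hs₀ hw hw₀ hrefl k
    _ = 2 * ((1 + 2 * s) ^ k * ∫ θ in (0)..(π / 2), (1 + 2 * s * cos θ) ^ k * w θ) := by ring
    _ ≤ 2 * (8 * ∫ θ in (0)..(π / 4), (1 + 2 * s * cos θ) ^ (2 * k) * w θ) := by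
        exact mul_le_mul_of_nonneg_left (integral_pow_mul_doubling hs₀ hw hw₀ hdbl k) two_pos.le
    _ ≤ 2 * (8 * ((1 + 2 * s) ^ (k - m) * (1 + 2 * s) *
          (radialStep (s ^ 2))^[m + k] (Pi.single 0 1) 0)) := by
        gcongr
        refine hquarter.trans ((mul_le_mul_of_nonneg_left hT (by positivity)).trans ?_)
        exact mul_le_mul_of_nonneg_right hpow hTnn
    _ = _ := by ring

end Weight

lemma iterate_radialStep_dist_le {s : ℝ} (hs : 1 ≤ s) {m k : ℕ} (hmk : m ≤ k) :
    (radialStep (s ^ 2))^[m] (fun r => r * (radialStep (s ^ 2))^[k] (Pi.single 0 1) r) 0 ≤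
      32 * (1 + 2 * s) * √m * (radialStep (s ^ 2))^[m + k] (Pi.single 0 1) 0 := by
  obtain ⟨w, hw, hw₀, hrefl, hdbl, hsph⟩ := exists_spectral_weight hs
  rcases Nat.eq_zero_or_pos m with rfl | hm
  · simp
  have hm' : 0 < √(m : ℝ) := sqrt_pos.2 (by exact_mod_cast hm)
  have hsq : √(m : ℝ) ^ 2 = m := sq_sqrt (Nat.cast_nonneg m)
  have hbound := integral_abs_pow_mul_le_iterate hs hw hw₀ hrefl hdbl hsph hmk
  have hT := iterate_radialStep_le_groundState hs hw hw₀ hsph k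
  set H := ∫ θ in (0)..π, |1 + 2 * s * cos θ| ^ k * w θ
  have hH : 0 ≤ H := integral_nonneg pi_pos.le fun θ _ => mul_nonneg (by positivity) (hw₀ θ)
  have hF : ∀ r : ℕ, r * (radialStep (s ^ 2))^[k] (Pi.single 0 1) r ≤
      groundState s r * (H / (2 * √m) * r ^ 2 + H * √m / 2) := by
    intro r
    refine (mul_le_mul_of_nonneg_left (hT r) (Nat.cast_nonneg r)).trans ?_
    have h : 0 ≤ groundState s r * H * ((r - √m) ^ 2 / (2 * √m)) :=
      mul_nonneg (mul_nonneg (groundState_nonneg hs r) hH) (by positivity)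
    refine sub_nonneg.1 (h.trans (le_of_eq ?_))
    field_simp
    ring
  refine (iterate_radialStep_le hs (by positivity) hF m 0).trans ?_
  rw [groundState_zero]
  calc _ = 2 * √m * ((1 + 2 * s) ^ m * H) := by
        nth_rewrite 4 [← hsq]
        push_cast
        field_simp
        ring
    _ ≤ 2 * √m * (16 * (1 + 2 * s) * (radialStep (s ^ 2))^[m + k] (Pi.single 0 1) 0) := by
        gcongr
    _ = _ := by ring

end Spectral

/-- The word metric on the free group for the standard generating set
is `d(x, y) = FreeGroup.norm (x⁻¹ * y)`. -/
theorem freeGroup_expected_dist_bound (d : ℕ) (hd : 1 ≤ d) :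
    ∃ C : ℝ, ∀ n s t : ℕ, s ≤ t → t ≤ n →
      (∑ w ∈ closedFreeWords d n, ((FreeGroup.norm ((freePos w s)⁻¹ * freePos w t)) : ℝ)) /
          ((closedFreeWords d n).card : ℝ)
        ≤ C * Real.sqrt ((t - s : ℕ) : ℝ) := by
  have hd' : (1 : ℝ) ≤ 2 * d - 1 := by
    have : (1 : ℝ) ≤ d := by exact_mod_cast hd
    linarith
  set σ := √(2 * d - 1 : ℝ)
  have hσ : 1 ≤ σ := Real.one_le_sqrt.2 hd'
  have hσ₂ : σ ^ 2 = 2 * d - 1 := Real.sq_sqrt (by linarith)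
  refine ⟨32 * (1 + 2 * σ), fun n s t hst htn => ?_⟩
  obtain ⟨m, rfl⟩ := Nat.exists_eq_add_of_le hst
  obtain ⟨r, rfl⟩ := Nat.exists_eq_add_of_le htn
  rw [Nat.add_sub_cancel_left, add_assoc]
  refine div_le_of_le_mul₀ (Nat.cast_nonneg _) (by positivity) ?_
  rw [sum_closedFreeWords_norm, card_closedFreeWords, ← hσ₂]
  rcases le_total m (r + s) with hmk | hmk
  · rw [sum_norm_mul_closed, ← hσ₂]
    rw [show s + (m + r) = m + (r + s) by omega]
    exact iterate_radialStep_dist_le hσ hmk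
  · rw [sum_norm_mul_closed_comm, sum_norm_mul_closed, ← hσ₂]
    refine (iterate_radialStep_dist_le hσ hmk).trans ?_
    rw [show s + (m + r) = r + s + m by omega]
    refine mul_le_mul_of_nonneg_right ?_
      (iterate_radialStep_single_nonneg (sq_nonneg σ) (r + s + m) 0)
    gcongr

end AvgDehnPaper
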